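/- arXiv:1308.5447 — 10 statements merged into one kernel-verified Lean document; each statement's English description precedes it below -/
import Mathlib

section
/- Let Φ = {φ_1, ..., φ_N} be a collection of vectors in ℝ^M satisfying the complement property. Then the intensity measurement map A : ℝ^M → ℝ^N defined by (A(x))(n) = |⟨φ_n, x⟩|² is injective up to global sign: for all x, y ∈ ℝ^M, if |⟨φ_n, x⟩|² = |⟨φ_n, y⟩|² for every n = 1, ..., N, then y = x or y = -x. -/
/-- A vector orthogonal to a spanning set is zero. -/
theorem eq_zero_of_orthogonal_span {M : ℕ} (T : Set (Fin M → ℝ))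
    (hT : Submodule.span ℝ T = ⊤) (z : Fin M → ℝ) (hz : ∀ v ∈ T, v ⬝ᵥ z = 0) : z = 0 := by
  have key : ∀ v ∈ Submodule.span ℝ T, v ⬝ᵥ z = 0 := by
    intro v hv
    induction hv using Submodule.span_induction with
    | mem v hv => exact hz v hv
    | zero => simp
    | add a b _ _ ha hb => rw [add_dotProduct, ha, hb, add_zero]
    | smul c a _ ha => rw [smul_dotProduct, ha, smul_zero]
  exact dotProduct_self_eq_zero.mp (key z (by rw [hT]; trivial))

/-- **Injectivity in the real case (sufficiency).**
If the collection `Φ = {φ_1, ..., φ_N} ⊆ ℝ^M` satisfies the complement property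
(for every `S ⊆ {1,...,N}`, either `{φ_n : n ∈ S}` or `{φ_n : n ∈ Sᶜ}` spans `ℝ^M`),
then the intensity measurement map `x ↦ (|⟨φ_n, x⟩|²)_n` is injective up to global sign. -/
theorem injective_up_to_sign_of_complement_property
    (M N : ℕ) (φ : Fin N → Fin M → ℝ)
    (hcp : ∀ S : Finset (Fin N),
      Submodule.span ℝ (φ '' (S : Set (Fin N))) = ⊤ ∨
      Submodule.span ℝ (φ '' ((Sᶜ : Finset (Fin N)) : Set (Fin N))) = ⊤)
    (x y : Fin M → ℝ)
    (h : ∀ n : Fin N, (∑ i, φ n i * x i) ^ 2 = (∑ i, φ n i * y i) ^ 2) :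
    y = x ∨ y = -x := by
  classical
  have h' : ∀ n, (φ n ⬝ᵥ x) ^ 2 = (φ n ⬝ᵥ y) ^ 2 := h
  rcases hcp (Finset.univ.filter fun n => φ n ⬝ᵥ y = φ n ⬝ᵥ x) with hS | hS
  · left
    refine sub_eq_zero.mp (eq_zero_of_orthogonal_span _ hS (y - x) ?_)
    rintro _ ⟨n, hn, rfl⟩
    have hn' : φ n ⬝ᵥ y = φ n ⬝ᵥ x := by simpa using hn
    rw [dotProduct_sub, hn', sub_self]
  · right
    refine eq_neg_of_add_eq_zero_left (eq_zero_of_orthogonal_span _ hS (y + x) ?_)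
    rintro _ ⟨n, hn, rfl⟩
    have hn' : ¬ φ n ⬝ᵥ y = φ n ⬝ᵥ x := by simpa using hn
    rcases sq_eq_sq_iff_eq_or_eq_neg.mp (h' n).symm with h1 | h1
    · exact absurd h1 hn'
    · rw [dotProduct_add, h1, neg_add_cancel]
end

section
/- Let Φ = {φ_1, ..., φ_N} be a collection of vectors in ℝ^M such that the intensity measurement map A : ℝ^M → ℝ^N defined by (A(x))(n) = |⟨φ_n, x⟩|² is injective up to global sign (i.e., A(x) = A(y) implies y = x or y = -x). Then Φ satisfies the complement property. -/
/-- A family that does not span has a nonzero orthogonal vector. -/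
theorem exists_orthogonal_of_span_ne_top {M : ℕ} (T : Set (Fin M → ℝ))
    (h : Submodule.span ℝ T ≠ ⊤) :
    ∃ u : Fin M → ℝ, u ≠ 0 ∧ ∀ w ∈ T, ∑ i, w i * u i = 0 := by
  obtain ⟨f, hf, hle⟩ := Submodule.exists_le_ker_of_lt_top _ (lt_top_iff_ne_top.mpr h)
  have key : ∀ w : Fin M → ℝ, f w = ∑ i, w i * f (fun j => if i = j then 1 else 0) := by
    intro w
    simpa using LinearMap.pi_apply_eq_sum_univ f w
  refine ⟨fun i => f (fun j => if i = j then 1 else 0), ?_, ?_⟩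
  · intro h0
    apply hf
    refine LinearMap.ext fun w => ?_
    rw [key w, LinearMap.zero_apply]
    refine Finset.sum_eq_zero fun i _ => ?_
    have h1 := congrFun h0 i
    simp only [Pi.zero_apply] at h1
    rw [h1, mul_zero]
  · intro w hw
    rw [← key]
    exact hle (Submodule.subset_span hw)

/-- **Injectivity in the real case (necessity).**
If the intensity measurement map `x ↦ (|⟨φ_n, x⟩|²)_n` associated with a collection
`Φ = {φ_1, ..., φ_N} ⊆ ℝ^M` is injective up to global sign, then `Φ` satisfies the
complement property: for every `S ⊆ {1,...,N}`, either `{φ_n : n ∈ S}` or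
`{φ_n : n ∈ Sᶜ}` spans `ℝ^M`. -/
theorem complement_property_of_injective_up_to_sign
    (M N : ℕ) (φ : Fin N → Fin M → ℝ)
    (hinj : ∀ x y : Fin M → ℝ,
      (∀ n : Fin N, (∑ i, φ n i * x i) ^ 2 = (∑ i, φ n i * y i) ^ 2) →
      y = x ∨ y = -x) :
    ∀ S : Finset (Fin N),
      Submodule.span ℝ (φ '' (S : Set (Fin N))) = ⊤ ∨
      Submodule.span ℝ (φ '' ((Sᶜ : Finset (Fin N)) : Set (Fin N))) = ⊤ := by
  intro S
  by_contra hc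
  rw [not_or] at hc
  obtain ⟨u, hu, hu'⟩ := exists_orthogonal_of_span_ne_top _ hc.1
  obtain ⟨v, hv, hv'⟩ := exists_orthogonal_of_span_ne_top _ hc.2
  have key := hinj (u + v) (u - v) (by
    intro n
    simp only [Pi.add_apply, Pi.sub_apply, mul_add, mul_sub, Finset.sum_add_distrib,
      Finset.sum_sub_distrib]
    by_cases hn : n ∈ S
    · rw [hu' (φ n) ⟨n, by simpa using hn, rfl⟩]
      ring
    · rw [hv' (φ n) ⟨n, by simpa using hn, rfl⟩]
      ring)
  rcases key with h | h
  · apply hv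
    ext i
    have := congrFun h i
    simp only [Pi.add_apply, Pi.sub_apply] at this
    simp only [Pi.zero_apply]
    linarith
  · apply hu
    ext i
    have := congrFun h i
    simp only [Pi.add_apply, Pi.sub_apply, Pi.neg_apply] at this
    simp only [Pi.zero_apply]
    linarith
end

section
/- Let M ≥ 1 and let Φ = {φ_1, ..., φ_N} be a collection of N vectors in ℝ^M with N < 2M - 1. Then Φ does not satisfy the complement property: there exists a subset S ⊆ {1, ..., N} such that neither {φ_n : n ∈ S} nor {φ_n : n ∈ S^c} spans ℝ^M. -/
theorem span_image_ne_top_of_card_lt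
    (M N : ℕ) (φ : Fin N → Fin M → ℝ) (T : Finset (Fin N)) (hT : T.card < M) :
    Submodule.span ℝ (φ '' (T : Set (Fin N))) ≠ ⊤ := by
  classical
  intro h
  have h1 := finrank_span_finset_le_card (R := ℝ) (T.image φ)
  rw [Set.finrank, Finset.coe_image, h, finrank_top, Module.finrank_fin_fun] at h1
  have h2 := Finset.card_image_le (s := T) (f := φ)
  omega

/-- **Necessity of `N ≥ 2M - 1` for the complement property.**
If `M ≥ 1` and `N < 2M - 1`, then no collection `Φ = {φ_1, ..., φ_N} ⊆ ℝ^M` satisfies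
the complement property: there is a subset `S ⊆ {1,...,N}` such that neither
`{φ_n : n ∈ S}` nor `{φ_n : n ∈ Sᶜ}` spans `ℝ^M`. -/
theorem not_complement_property_of_lt
    (M N : ℕ) (hM : 1 ≤ M) (hN : N < 2 * M - 1) (φ : Fin N → Fin M → ℝ) :
    ∃ S : Finset (Fin N),
      Submodule.span ℝ (φ '' (S : Set (Fin N))) ≠ ⊤ ∧
      Submodule.span ℝ (φ '' ((Sᶜ : Finset (Fin N)) : Set (Fin N))) ≠ ⊤ := by
  obtain ⟨S, -, hS⟩ := Finset.exists_subset_card_eq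
    (s := (Finset.univ : Finset (Fin N))) (n := min N (M - 1)) (by simp)
  refine ⟨S, span_image_ne_top_of_card_lt M N φ S (by omega),
    span_image_ne_top_of_card_lt M N φ Sᶜ ?_⟩
  rw [Finset.card_compl, Fintype.card_fin]
  omega
end

section
/- Let M ≥ 1 and let Φ = {φ_1, ..., φ_N} be a collection of N vectors in ℝ^M with N < 2M - 1. Then the intensity measurement map A : ℝ^M → ℝ^N defined by (A(x))(n) = |⟨φ_n, x⟩|² is not injective up to global sign: there exist x, y ∈ ℝ^M with A(x) = A(y), y ≠ x and y ≠ -x. -/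
lemma exists_ne_zero_orthogonal (M K : ℕ) (h : K < M) (ψ : Fin K → Fin M → ℝ) :
    ∃ u : Fin M → ℝ, u ≠ 0 ∧ ∀ k, ∑ i, ψ k i * u i = 0 := by
  have hk : LinearMap.ker (Matrix.mulVecLin (Matrix.of ψ)) ≠ ⊥ :=
    LinearMap.ker_ne_bot_of_finrank_lt (by simpa using h)
  obtain ⟨u, hu, hne⟩ := Submodule.exists_mem_ne_zero_of_ne_bot hk
  refine ⟨u, hne, fun k => ?_⟩
  have := congrFun (LinearMap.mem_ker.mp hu) k
  simpa [Matrix.mulVec, dotProduct] using this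

/-- **Necessity of `N ≥ 2M - 1` intensity measurements.**
If `M ≥ 1` and `N < 2M - 1`, then for any collection `Φ = {φ_1, ..., φ_N} ⊆ ℝ^M` the
intensity measurement map `x ↦ (|⟨φ_n, x⟩|²)_n` is not injective up to global sign:
there exist `x, y ∈ ℝ^M` with equal measurements, `y ≠ x` and `y ≠ -x`. -/
theorem not_injective_up_to_sign_of_lt
    (M N : ℕ) (hM : 1 ≤ M) (hN : N < 2 * M - 1) (φ : Fin N → Fin M → ℝ) :
    ∃ x y : Fin M → ℝ,
      (∀ n : Fin N, (∑ i, φ n i * x i) ^ 2 = (∑ i, φ n i * y i) ^ 2) ∧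
      y ≠ x ∧ y ≠ -x := by
  obtain ⟨u, hu, hu'⟩ := exists_ne_zero_orthogonal M (M - 1) (by omega)
    (fun k => if h : k.val < N then φ ⟨k.val, h⟩ else 0)
  obtain ⟨v, hv, hv'⟩ := exists_ne_zero_orthogonal M (M - 1) (by omega)
    (fun k => if h : k.val + (M - 1) < N then φ ⟨k.val + (M - 1), h⟩ else 0)
  refine ⟨u + v, u - v, fun n => ?_, fun h => hv ?_, fun h => hu ?_⟩
  · simp only [Pi.add_apply, Pi.sub_apply, mul_add, mul_sub, Finset.sum_add_distrib,
      Finset.sum_sub_distrib]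
    by_cases hn : n.val < M - 1
    · have h1 := hu' ⟨n.val, hn⟩
      simp only [n.isLt, dite_true] at h1
      rw [h1]; ring
    · have h1 := hv' ⟨n.val - (M - 1), by have := n.isLt; omega⟩
      have e : n.val - (M - 1) + (M - 1) = n.val := by omega
      simp only [e, n.isLt, dite_true] at h1
      rw [h1]; ring
  · ext i
    have := congrFun h i
    simp only [Pi.add_apply, Pi.sub_apply] at this
    simp only [Pi.zero_apply]; linarith
  · ext i
    have := congrFun h i
    simp only [Pi.add_apply, Pi.sub_apply, Pi.neg_apply] at this
    simp only [Pi.zero_apply]; linarith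
end

section
/- Let Φ = {φ_1, ..., φ_N} be a collection of vectors in ℝ^M and let x₀ ∈ ℝ^M with ‖x₀‖₀ = k (i.e., x₀ has exactly k nonzero entries), where 2k ≤ M. Suppose Φ satisfies the 2k-complement property. Then x₀ is the unique real vector, up to global sign, with at most k nonzero entries consistent with the intensity measurements: for every x̃ ∈ ℝ^M with ‖x̃‖₀ ≤ k and |⟨φ_n, x̃⟩|² = |⟨φ_n, x₀⟩|² for all n = 1, ..., N, it holds that x̃ = x₀ or x̃ = -x₀. -/
/-- A collection `Φ = {φ_1, ..., φ_N} ⊆ ℝ^M` satisfies the `k`-complement property if for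
every `S ⊆ {1,...,N}` and every `K ⊆ {1,...,M}` with `|K| = k`, either the restrictions
`{φ_{n,K} : n ∈ S}` or `{φ_{n,K} : n ∈ Sᶜ}` span `ℝ^k` (identified with `K → ℝ`). -/
def KComplementProperty {M N : ℕ} (k : ℕ) (φ : Fin N → Fin M → ℝ) : Prop :=
  ∀ (S : Finset (Fin N)) (K : Finset (Fin M)), K.card = k →
    (Submodule.span ℝ ((fun n => fun i : K => φ n i.1) '' (S : Set (Fin N))) = ⊤ ∨
     Submodule.span ℝ ((fun n => fun i : K => φ n i.1) ''
        ((Sᶜ : Finset (Fin N)) : Set (Fin N))) = ⊤)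

/-- A vector supported on `K` and orthogonal to vectors whose restrictions span is zero. -/
theorem eq_zero_of_span_restrict {M N : ℕ} (φ : Fin N → Fin M → ℝ) (K : Finset (Fin M))
    (T : Set (Fin N)) (v : Fin M → ℝ) (hv : ∀ i, i ∉ K → v i = 0)
    (hT : Submodule.span ℝ ((fun n => fun i : K => φ n i.1) '' T) = ⊤)
    (h : ∀ n ∈ T, ∑ i, φ n i * v i = 0) : v = 0 := by
  have key : ∀ w : K → ℝ, ∑ i : K, w i * v i.1 = 0 := by
    intro w
    have hw : w ∈ Submodule.span ℝ ((fun n => fun i : K => φ n i.1) '' T) := by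
      rw [hT]; trivial
    induction hw using Submodule.span_induction with
    | mem x hx =>
      obtain ⟨n, hn, rfl⟩ := hx
      have h1 := h n hn
      rw [← Finset.sum_subset (Finset.subset_univ K)
        (fun i _ hi => by rw [hv i hi, mul_zero])] at h1
      rw [← h1]
      exact Finset.sum_coe_sort K (fun i => φ n i * v i)
    | zero => simp
    | add x y _ _ hx hy => simp only [Pi.add_apply, add_mul, Finset.sum_add_distrib, hx, hy, add_zero]
    | smul a x _ hx => simp only [Pi.smul_apply, smul_eq_mul, mul_assoc, ← Finset.mul_sum, hx, mul_zero]
  funext i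
  by_cases hi : i ∈ K
  · have h2 := key (Pi.single ⟨i, hi⟩ 1)
    simpa [Pi.single_apply] using h2
  · exact hv i hi

/-- **Unique recovery in the sparse real case.**
Let `x₀ ∈ ℝ^M` have exactly `k` nonzero entries, with `2k ≤ M`, and suppose the
collection `Φ = {φ_1, ..., φ_N} ⊆ ℝ^M` satisfies the `2k`-complement property. Then
`x₀` is, up to global sign, the unique vector with at most `k` nonzero entries that is
consistent with the intensity measurements `|⟨φ_n, x₀⟩|²`. -/
theorem unique_sparse_recovery_of_twoK_complement
    (M N k : ℕ) (φ : Fin N → Fin M → ℝ) (x₀ : Fin M → ℝ)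
    (hx₀ : (Finset.univ.filter fun i => x₀ i ≠ 0).card = k)
    (hkM : 2 * k ≤ M)
    (hcp : KComplementProperty (2 * k) φ) :
    ∀ x' : Fin M → ℝ,
      (Finset.univ.filter fun i => x' i ≠ 0).card ≤ k →
      (∀ n : Fin N, (∑ i, φ n i * x' i) ^ 2 = (∑ i, φ n i * x₀ i) ^ 2) →
      x' = x₀ ∨ x' = -x₀ := by
  intro x' hx' hm
  obtain ⟨K, hK, hKc⟩ : ∃ K : Finset (Fin M),
      (Finset.univ.filter fun i => x₀ i ≠ 0) ∪ (Finset.univ.filter fun i => x' i ≠ 0) ⊆ K ∧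
        K.card = 2 * k := by
    apply Finset.exists_superset_card_eq
    · have := Finset.card_union_le (Finset.univ.filter fun i => x₀ i ≠ 0)
        (Finset.univ.filter fun i => x' i ≠ 0)
      omega
    · simpa using hkM
  have h0 : ∀ i, i ∉ K → x₀ i = 0 ∧ x' i = 0 := by
    intro i hi
    constructor
    · by_contra hc
      exact hi (hK (by simp [hc]))
    · by_contra hc
      exact hi (hK (by simp [hc]))
  rcases hcp (Finset.univ.filter fun n => ∑ i, φ n i * x' i = ∑ i, φ n i * x₀ i) K hKc with h | h
  · left
    have := eq_zero_of_span_restrict φ K _ (x' - x₀)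
      (fun i hi => by simp [h0 i hi]) h (fun n hn => by
        have hn' : ∑ i, φ n i * x' i = ∑ i, φ n i * x₀ i := by simpa using hn
        simp [mul_sub, Finset.sum_sub_distrib, hn'])
    exact sub_eq_zero.mp this
  · right
    have := eq_zero_of_span_restrict φ K _ (x' + x₀)
      (fun i hi => by simp [h0 i hi]) h (fun n hn => by
        have hn' : ¬ ∑ i, φ n i * x' i = ∑ i, φ n i * x₀ i := by simpa using hn
        have h3 := (sq_eq_sq_iff_eq_or_eq_neg.mp (hm n)).resolve_left hn'
        simp [mul_add, Finset.sum_add_distrib, h3])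
    exact eq_neg_of_add_eq_zero_left this
end

section
/- Let M ≥ 1 and 1 ≤ k ≤ M, and set N = min(4k - 1, 2M - 1). Then there exists a collection Φ = {φ_1, ..., φ_N} of N vectors in ℝ^M such that every k-sparse vector is uniquely determined, up to global sign, by its intensity measurements: for all x, x̃ ∈ ℝ^M with ‖x‖₀ ≤ k, ‖x̃‖₀ ≤ k, and |⟨φ_n, x̃⟩|² = |⟨φ_n, x⟩|² for all n = 1, ..., N, it holds that x̃ = x or x̃ = -x. -/
open Polynomial in
/-- A Cauchy system: a vector supported on `S` that is annihilated by at least `#S` of the rows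
`1 / (n + 1 + i)` vanishes. -/
theorem cauchy_aux {M N : ℕ} (S : Finset (Fin M)) (T : Finset (Fin N)) (hST : S.card ≤ T.card)
    (w : Fin M → ℝ) (hw : ∀ i, i ∉ S → w i = 0)
    (hT : ∀ n ∈ T, ∑ i : Fin M, (((n : ℕ) : ℝ) + 1 + ((i : ℕ) : ℝ))⁻¹ * w i = 0) : w = 0 := by
  classical
  let P : ℝ[X] := ∑ i ∈ S, C (w i) * ∏ j ∈ S.erase i, (X + C (((j : ℕ) : ℝ)))
  have hdeg : P.degree < T.card := by
    refine lt_of_lt_of_le ?_ (Nat.cast_le.mpr hST)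
    refine (Polynomial.degree_sum_le _ _).trans_lt ?_
    rw [Finset.sup_lt_iff (WithBot.bot_lt_coe _)]
    intro i hi
    refine ((Polynomial.degree_mul_le _ _).trans
      (add_le_add_left Polynomial.degree_C_le _)).trans_lt ?_
    rw [zero_add, Polynomial.degree_prod]
    simp only [Polynomial.degree_X_add_C, Finset.sum_const, nsmul_eq_mul, mul_one]
    exact_mod_cast Finset.card_erase_lt_of_mem hi
  have hP : P = 0 := by
    refine Polynomial.eq_zero_of_degree_lt_of_eval_index_eq_zero
      (s := T) (v := fun n : Fin N => ((n : ℕ) : ℝ) + 1) ?_ hdeg ?_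
    · intro a _ b _ hab
      simpa [Fin.ext_iff] using hab
    · intro n hn
      have h1 : ∑ i ∈ S, (((n : ℕ) : ℝ) + 1 + ((i : ℕ) : ℝ))⁻¹ * w i = 0 := by
        rw [← hT n hn]
        refine Finset.sum_subset (Finset.subset_univ _) ?_
        intro i _ hi
        rw [hw i hi, mul_zero]
      have h2 : P.eval (((n : ℕ) : ℝ) + 1) =
          (∏ j ∈ S, (((n : ℕ) : ℝ) + 1 + ((j : ℕ) : ℝ))) *
            ∑ i ∈ S, (((n : ℕ) : ℝ) + 1 + ((i : ℕ) : ℝ))⁻¹ * w i := by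
        simp only [P, Polynomial.eval_finsetSum, Polynomial.eval_mul, Polynomial.eval_C,
          Polynomial.eval_prod, Polynomial.eval_add, Polynomial.eval_X]
        rw [Finset.mul_sum]
        refine Finset.sum_congr rfl fun i hi => ?_
        rw [← Finset.mul_prod_erase S _ hi]
        have : ((n : ℕ) : ℝ) + 1 + ((i : ℕ) : ℝ) ≠ 0 := by positivity
        field_simp
      rw [h2, h1, mul_zero]
  funext i
  by_cases hi : i ∈ S
  swap
  · exact hw i hi
  have h3 : P.eval (-((i : ℕ) : ℝ)) = 0 := by rw [hP, Polynomial.eval_zero]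
  simp only [P, Polynomial.eval_finsetSum, Polynomial.eval_mul, Polynomial.eval_C,
    Polynomial.eval_prod, Polynomial.eval_add, Polynomial.eval_X] at h3
  rw [Finset.sum_eq_single_of_mem i hi] at h3
  · rcases mul_eq_zero.mp h3 with h | h
    · exact h
    · obtain ⟨j, hj, hj0⟩ := Finset.prod_eq_zero_iff.mp h
      have h4 : ((j : ℕ) : ℝ) = ((i : ℕ) : ℝ) := by linarith
      exact absurd (Fin.ext (Nat.cast_injective h4)) (Finset.ne_of_mem_erase hj)
  · intro l _ hl
    rw [Finset.prod_eq_zero (Finset.mem_erase.mpr ⟨hl.symm, hi⟩) (by ring), mul_zero]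

/-- **`min(4k-1, 2M-1)` measurements suffice for unique sparse recovery.**
For `M ≥ 1` and `1 ≤ k ≤ M`, there exists a collection of `N = min(4k-1, 2M-1)`
measurement vectors in `ℝ^M` such that every `k`-sparse vector is uniquely determined,
up to global sign, by its intensity measurements. -/
theorem exists_measurements_unique_sparse_recovery
    (M k : ℕ) (hM : 1 ≤ M) (hk : 1 ≤ k) (hkM : k ≤ M) :
    ∃ φ : Fin (min (4 * k - 1) (2 * M - 1)) → Fin M → ℝ,
      ∀ x x' : Fin M → ℝ,
        (Finset.univ.filter fun i => x i ≠ 0).card ≤ k →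
        (Finset.univ.filter fun i => x' i ≠ 0).card ≤ k →
        (∀ n, (∑ i, φ n i * x' i) ^ 2 = (∑ i, φ n i * x i) ^ 2) →
        x' = x ∨ x' = -x := by
  classical
  refine ⟨fun n i => (((n : ℕ) : ℝ) + 1 + ((i : ℕ) : ℝ))⁻¹, ?_⟩
  intro x x' hx hx' h
  set S := (Finset.univ.filter fun i => x i ≠ 0) ∪ (Finset.univ.filter fun i => x' i ≠ 0) with hS
  have hSk : S.card ≤ k + k := (Finset.card_union_le _ _).trans (Nat.add_le_add hx hx')
  have hSM : S.card ≤ M := by simpa using Finset.card_le_univ S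
  have hS0 : ∀ i, i ∉ S → x i = 0 ∧ x' i = 0 := by
    intro i hi
    simpa [hS, not_or] using hi
  set T₁ := Finset.univ.filter fun n : Fin (min (4 * k - 1) (2 * M - 1)) =>
    ∑ i : Fin M, (((n : ℕ) : ℝ) + 1 + ((i : ℕ) : ℝ))⁻¹ * (x' - x) i = 0 with hT₁
  set T₂ := Finset.univ.filter fun n : Fin (min (4 * k - 1) (2 * M - 1)) =>
    ∑ i : Fin M, (((n : ℕ) : ℝ) + 1 + ((i : ℕ) : ℝ))⁻¹ * (x' + x) i = 0 with hT₂
  have hun : T₁ ∪ T₂ = Finset.univ := by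
    ext n
    simp only [hT₁, hT₂, Finset.mem_union, Finset.mem_filter, Finset.mem_univ, true_and, iff_true,
      Pi.sub_apply, Pi.add_apply, mul_sub, mul_add, Finset.sum_sub_distrib,
      Finset.sum_add_distrib]
    rcases sq_eq_sq_iff_eq_or_eq_neg.mp (h n) with h' | h'
    · left; linarith
    · right; linarith
  have hcard : min (4 * k - 1) (2 * M - 1) ≤ T₁.card + T₂.card := by
    have := Finset.card_union_le T₁ T₂
    rw [hun] at this
    simpa using this
  have hor : S.card ≤ T₁.card ∨ S.card ≤ T₂.card := by omega
  rcases hor with hc | hc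
  · left
    refine sub_eq_zero.mp (cauchy_aux S T₁ hc (x' - x) ?_ ?_)
    · intro i hi
      simp [hS0 i hi]
    · intro n hn
      exact (Finset.mem_filter.mp hn).2
  · right
    refine eq_neg_of_add_eq_zero_left (cauchy_aux S T₂ hc (x' + x) ?_ ?_)
    · intro i hi
      simp [hS0 i hi]
    · intro n hn
      exact (Finset.mem_filter.mp hn).2
end

section
/- Let M ≥ 1 and 1 ≤ k with 2k ≤ M. Let φ_1, ..., φ_{4k-1} be independent random vectors in ℝ^M, each with independent standard Gaussian (mean 0, variance 1) entries; i.e., consider the product Gaussian measure on (ℝ^M)^{4k-1}. Then, with probability 1, the collection Φ = {φ_1, ..., φ_{4k-1}} satisfies the 2k-complement property. -/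
open MeasureTheory ProbabilityTheory

/-- Powers of absolutely continuous measures are absolutely continuous. -/
theorem pi_fin_absolutelyContinuous {α : Type*} [MeasurableSpace α] (μ ν : Measure α)
    [SigmaFinite μ] [SigmaFinite ν] (h : μ ≪ ν) (n : ℕ) :
    (Measure.pi fun _ : Fin n => μ) ≪ (Measure.pi fun _ : Fin n => ν) := by
  induction n with
  | zero =>
    rw [Measure.pi_of_empty (fun _ : Fin 0 => μ), Measure.pi_of_empty (fun _ : Fin 0 => ν)]
  | succ n ih =>
    have h1 := (measurePreserving_piFinSuccAbove (fun _ : Fin (n + 1) => μ) 0).symm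
    have h2 := (measurePreserving_piFinSuccAbove (fun _ : Fin (n + 1) => ν) 0).symm
    rw [← h1.map_eq, ← h2.map_eq]
    exact (h.prod ih).map h1.measurable

/-- A fixed square minor is almost surely nonzero with respect to Lebesgue measure. -/
theorem ae_det_ne_zero {M N : ℕ} (K : Finset (Fin M)) (e : K → Fin N)
    (he : Function.Injective e) :
    ∀ᵐ φ : Fin N → Fin M → ℝ, (Matrix.of fun i j : K => φ (e i) j.1).det ≠ 0 := by
  classical
  let P : Fin N → Fin M → ℝ := fun n m => if ∃ i : K, e i = n ∧ i.1 = m then 1 else 0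
  let L : ℝ →ₗ[ℝ] (Fin N → Fin M → ℝ) := LinearMap.toSpanSingleton ℝ _ P
  have hmeas : MeasurableSet {φ : Fin N → Fin M → ℝ |
      (Matrix.of fun i j : K => φ (e i) j.1).det ≠ 0} := by
    have hc : Continuous fun φ : Fin N → Fin M → ℝ =>
        (Matrix.of fun i j : K => φ (e i) j.1).det := by
      apply Continuous.matrix_det
      refine continuous_matrix fun i j => ?_
      simp only [Matrix.of_apply]
      fun_prop
    exact (isOpen_ne.preimage hc).measurableSet
  refine ae_mem_of_ae_add_linearMap_mem L volume volume hmeas fun y => ?_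
  set A : Matrix K K ℝ := Matrix.of fun i j : K => y (e i) j.1 with hA
  have hne : (-A).charpoly ≠ 0 := (Matrix.charpoly_monic _).ne_zero
  have hfin : {t : ℝ | (-A).charpoly.IsRoot t}.Finite := Polynomial.finite_setOfPred_isRoot hne
  filter_upwards [hfin.countable.ae_notMem volume] with t ht
  have : (Matrix.of fun i j : K => (y + L t) (e i) j.1) = Matrix.scalar K t - (-A) := by
    ext i j
    have hP : P (e i) j.1 = if i = j then 1 else 0 := by
      simp only [P]
      congr 1
      apply propext
      constructor
      · rintro ⟨l, hl, hl'⟩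
        exact (he hl).symm.trans (Subtype.ext hl')
      · rintro rfl
        exact ⟨i, rfl, rfl⟩
    simp [L, hA, hP, Matrix.diagonal_apply, add_comm]
  change (Matrix.of fun i j : K => (y + L t) (e i) j.1).det ≠ 0
  rw [this, ← Matrix.eval_charpoly]
  exact ht

/-- A collection `Φ = {φ_1, ..., φ_N} ⊆ ℝ^M` with all minors nonzero: large subsets span. -/
theorem span_eq_top_of_minors {M N : ℕ} (φ : Fin N → Fin M → ℝ) (K : Finset (Fin M))
    (h : ∀ e : K → Fin N, Function.Injective e →
      (Matrix.of fun i j : K => φ (e i) j.1).det ≠ 0)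
    (T : Finset (Fin N)) (hT : K.card ≤ T.card) :
    Submodule.span ℝ ((fun n => fun i : K => φ n i.1) '' (T : Set (Fin N))) = ⊤ := by
  classical
  obtain ⟨f⟩ : Nonempty (K ↪ T) :=
    Function.Embedding.nonempty_of_card_le (by simpa using hT)
  have hd := h (fun i => (f i).1) (Subtype.val_injective.comp f.injective)
  have hli : LinearIndependent ℝ (Matrix.of fun i j : K => φ (f i).1 j.1).row :=
    Matrix.linearIndependent_rows_iff_isUnit.2
      ((Matrix.isUnit_iff_isUnit_det _).2 hd.isUnit)
  have htop := hli.span_eq_top_of_card_eq_finrank' (by simp)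
  rw [eq_top_iff, ← htop]
  apply Submodule.span_mono
  rintro _ ⟨i, rfl⟩
  exact ⟨(f i).1, (f i).2, rfl⟩

/-- **Gaussian measurement vectors satisfy the `2k`-complement property a.s.**
For `1 ≤ k` and `2k ≤ M`, a collection of `4k - 1` independent vectors in `ℝ^M`, each
with i.i.d. standard Gaussian entries (i.e., a sample from the standard Gaussian product
measure on `(ℝ^M)^{4k-1}`), satisfies the `2k`-complement property with probability 1. -/
theorem gaussian_satisfies_twoK_complement_property_ae
    (M k : ℕ) (hk : 1 ≤ k) (hkM : 2 * k ≤ M) :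
    ∀ᵐ φ ∂(Measure.pi fun _ : Fin (4 * k - 1) =>
        Measure.pi fun _ : Fin M => gaussianReal 0 1),
      KComplementProperty (2 * k) φ := by
  have hac : (Measure.pi fun _ : Fin (4 * k - 1) => Measure.pi fun _ : Fin M => gaussianReal 0 1)
      ≪ (volume : Measure (Fin (4 * k - 1) → Fin M → ℝ)) :=
    pi_fin_absolutelyContinuous _ _
      (pi_fin_absolutelyContinuous _ _ (gaussianReal_absolutelyContinuous 0 one_ne_zero) M) _
  apply hac.ae_le
  have hall : ∀ᵐ φ : Fin (4 * k - 1) → Fin M → ℝ, ∀ (K : Finset (Fin M))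
      (e : K → Fin (4 * k - 1)), Function.Injective e →
      (Matrix.of fun i j : K => φ (e i) j.1).det ≠ 0 := by
    refine ae_all_iff.2 fun K => ae_all_iff.2 fun e => ?_
    by_cases he : Function.Injective e
    · filter_upwards [ae_det_ne_zero K e he] with φ hφ _ using hφ
    · exact Filter.Eventually.of_forall fun φ h => absurd h he
  filter_upwards [hall] with φ hφ S K hK
  have hc := Finset.card_add_card_compl S
  rw [Fintype.card_fin] at hc
  rcases le_or_gt (2 * k) S.card with h | h
  · exact Or.inl (span_eq_top_of_minors φ K (hφ K) S (by omega))
  · exact Or.inr (span_eq_top_of_minors φ K (hφ K) Sᶜ (by omega))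
end

section
/- Let M ≥ 1 and let φ_1, ..., φ_{2M-1} be independent random vectors in ℝ^M, each with independent standard Gaussian (mean 0, variance 1) entries; i.e., consider the product Gaussian measure on (ℝ^M)^{2M-1}. Then, with probability 1, the collection Φ = {φ_1, ..., φ_{2M-1}} satisfies the complement property. -/
open MeasureTheory ProbabilityTheory

/-- One-coordinate Fubini principle for finite products. -/
lemma ae_pi_of_forall_update {E : Type} [MeasurableSpace E] (μ : Measure E)
    [IsProbabilityMeasure μ] {N : ℕ} (i : Fin N) {p : (Fin N → E) → Prop}
    (hp : MeasurableSet {φ | p φ})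
    (h : ∀ φ : Fin N → E, ∀ᵐ x ∂μ, p (Function.update φ i x)) :
    ∀ᵐ φ ∂(Measure.pi fun _ : Fin N => μ), p φ := by
  cases N with
  | zero => exact i.elim0
  | succ n =>
    have mp := measurePreserving_piFinSuccAbove (fun _ : Fin (n + 1) => μ) i
    have mps := mp.symm
    rw [← mps.map_eq, ae_map_iff mps.measurable.aemeasurable hp]
    have hm := mps.measurable hp
    refine (Measure.ae_prod_iff_ae_ae hm).2 ?_
    refine (Measure.ae_ae_comm (p := fun x f => p ((MeasurableEquiv.piFinSuccAbove (fun _ => E) i).symm (x, f))) hm).2 ?_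
    refine Filter.Eventually.of_forall fun f => ?_
    have : Nonempty E := nonempty_of_isProbabilityMeasure μ
    filter_upwards [h (i.insertNth (Classical.arbitrary E) f)] with x hx
    have e : Function.update (i.insertNth (α := fun _ => E) (Classical.arbitrary E) f) i x
        = (MeasurableEquiv.piFinSuccAbove (fun _ => E) i).symm (x, f) := by
      simp only [Fin.update_insertNth]
      rfl
    rwa [e] at hx

/-- Proper subspaces are null for the standard Gaussian measure. -/
lemma ae_notMem_of_ne_top {M : ℕ} (W : Submodule ℝ (Fin M → ℝ)) (hW : W ≠ ⊤) :
    ∀ᵐ x ∂(Measure.pi fun _ : Fin M => gaussianReal 0 1), x ∉ W := by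
  obtain ⟨f, hf, hWf⟩ := Submodule.exists_le_ker_of_lt_top W (lt_top_iff_ne_top.2 hW)
  have hi : ∃ i, f (Pi.single i 1) ≠ 0 := by
    by_contra! hc
    apply hf
    ext i
    simpa using hc i
  obtain ⟨i, hi⟩ := hi
  have hcont : Continuous f := f.continuous_of_finiteDimensional
  have key : ∀ᵐ x ∂(Measure.pi fun _ : Fin M => gaussianReal 0 1), f x ≠ 0 := by
    refine ae_pi_of_forall_update (gaussianReal 0 1) i (p := fun x => f x ≠ 0)
      (isOpen_ne_fun hcont continuous_const).measurableSet fun x => ?_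
    have := nullSingletonClass_gaussianReal (μ := 0) (v := 1) one_ne_zero
    have hne : ∀ᵐ t ∂(gaussianReal 0 1), t ≠ - f (Function.update x i 0) / f (Pi.single i 1) :=
      Measure.ae_ne _ _
    filter_upwards [hne] with t ht h0
    apply ht
    have e : Function.update x i t = Function.update x i 0 + t • Pi.single i (1 : ℝ) := by
      ext j
      by_cases hj : j = i
      · subst hj; simp
      · simp [hj]
    rw [e, map_add, map_smul, smul_eq_mul] at h0
    rw [eq_div_iff hi]
    linarith
  filter_upwards [key] with x hx hxW
  exact hx (hWf hxW)

lemma isOpen_linearIndepOn {M N : ℕ} (T : Finset (Fin N)) :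
    IsOpen {φ : Fin N → Fin M → ℝ | LinearIndepOn ℝ φ (T : Set (Fin N))} := by
  have h := isOpen_setOfPred_linearIndependent (𝕜 := ℝ) (E := Fin M → ℝ)
    (ι := (T : Set (Fin N)))
  have hc : Continuous fun (φ : Fin N → Fin M → ℝ) (j : (T : Set (Fin N))) => φ j := by fun_prop
  exact h.preimage hc

lemma ae_linearIndepOn {M N : ℕ} (T : Finset (Fin N)) (hT : T.card ≤ M) :
    ∀ᵐ φ ∂(Measure.pi fun _ : Fin N => Measure.pi fun _ : Fin M => gaussianReal 0 1),
      LinearIndepOn ℝ φ (T : Set (Fin N)) := by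
  induction T using Finset.induction_on with
  | empty => simp
  | insert i T hi ih =>
    rw [Finset.card_insert_of_notMem hi] at hT
    have key : ∀ᵐ φ ∂(Measure.pi fun _ : Fin N => Measure.pi fun _ : Fin M => gaussianReal 0 1),
        LinearIndepOn ℝ φ (T : Set (Fin N)) →
          LinearIndepOn ℝ φ ((insert i T : Finset (Fin N)) : Set (Fin N)) := by
      refine ae_pi_of_forall_update _ i
        (p := fun φ => LinearIndepOn ℝ φ (T : Set (Fin N)) →
          LinearIndepOn ℝ φ ((insert i T : Finset (Fin N)) : Set (Fin N)))
        ((isOpen_linearIndepOn T).measurableSet.imp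
          (isOpen_linearIndepOn (insert i T)).measurableSet) fun φ => ?_
      have hne : Submodule.span ℝ (φ '' (T : Set (Fin N))) ≠ ⊤ := by
        intro htop
        classical
        have h1 := finrank_span_finset_le_card (R := ℝ) (T.image φ)
        rw [Finset.coe_image, Set.finrank, htop, finrank_top, Module.finrank_fin_fun] at h1
        have h2 := Finset.card_image_le (s := T) (f := φ)
        omega
      filter_upwards [ae_notMem_of_ne_top _ hne] with x hx hind
      rw [Finset.coe_insert, linearIndepOn_insert (by simpa using hi)]
      refine ⟨hind, ?_⟩
      have e : Function.update φ i x '' (T : Set (Fin N)) = φ '' (T : Set (Fin N)) := by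
        refine Set.image_congr fun j hj => ?_
        have : j ≠ i := fun h => hi (by simpa [h] using hj)
        simp [this]
      rwa [e, Function.update_self]
    filter_upwards [key, ih (by omega)] with φ h1 h2
    exact h1 h2



/-- **Gaussian measurement vectors satisfy the complement property a.s.**
For `M ≥ 1`, a collection of `2M - 1` independent vectors in `ℝ^M`, each with i.i.d.
standard Gaussian entries (i.e., a sample from the standard Gaussian product measure on
`(ℝ^M)^{2M-1}`), satisfies the complement property with probability 1: for every subset
`S` of the indices, either `{φ_n : n ∈ S}` or `{φ_n : n ∈ Sᶜ}` spans `ℝ^M`. -/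
theorem gaussian_satisfies_complement_property_ae
    (M : ℕ) (hM : 1 ≤ M) :
    ∀ᵐ φ ∂(Measure.pi fun _ : Fin (2 * M - 1) =>
        Measure.pi fun _ : Fin M => gaussianReal 0 1),
      ∀ S : Finset (Fin (2 * M - 1)),
        Submodule.span ℝ (φ '' (S : Set (Fin (2 * M - 1)))) = ⊤ ∨
        Submodule.span ℝ (φ '' ((Sᶜ : Finset (Fin (2 * M - 1))) : Set (Fin (2 * M - 1)))) = ⊤ := by
  have hall : ∀ᵐ φ ∂(Measure.pi fun _ : Fin (2 * M - 1) =>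
        Measure.pi fun _ : Fin M => gaussianReal 0 1),
      ∀ T : Finset (Fin (2 * M - 1)), T.card ≤ M →
        LinearIndepOn ℝ φ (T : Set (Fin (2 * M - 1))) := by
    rw [ae_all_iff]
    intro T
    by_cases hT : T.card ≤ M
    · filter_upwards [ae_linearIndepOn T hT] with φ h _ using h
    · exact Filter.Eventually.of_forall fun φ h => absurd h hT
  filter_upwards [hall] with φ hφ S
  have big : ∀ S : Finset (Fin (2 * M - 1)), M ≤ S.card →
      Submodule.span ℝ (φ '' (S : Set (Fin (2 * M - 1)))) = ⊤ := by
    intro S hS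
    obtain ⟨T, hTS, hT⟩ := Finset.exists_subset_card_eq hS
    have hli : LinearIndependent ℝ fun j : T => φ j := hφ T hT.le
    have htop := hli.span_eq_top_of_card_eq_finrank' (by simp [hT])
    rw [eq_top_iff, ← htop]
    apply Submodule.span_mono
    rintro _ ⟨j, rfl⟩
    exact ⟨j, hTS j.2, rfl⟩
  have hc := Finset.card_add_card_compl S
  rw [Fintype.card_fin] at hc
  by_cases h : M ≤ S.card
  · exact Or.inl (big S h)
  · exact Or.inr (big Sᶜ (by omega))
end

section
/- Let x ∈ ℝ^M be collision free with ‖x‖₀ = k, and let a ∈ ℝ^{2M-1} be its autocorrelation, a(l) = Σ_{s = max(1, 1-l)}^{min(M, M-l)} x(s)·x(s+l) for l = 1-M, ..., M-1. Then a has at most k² - k + 1 nonzero entries. -/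
/-- The entries of `x ∈ ℝ^M` with 1-based indexing, extended by zero to all of `ℤ`:
`zext x i = x(i)` for `1 ≤ i ≤ M` and `0` otherwise. -/
noncomputable def zext {M : ℕ} (x : Fin M → ℝ) : ℤ → ℝ := fun i =>
  if h : 1 ≤ i ∧ i ≤ (M : ℤ) then x ⟨(i - 1).toNat, by omega⟩ else 0

/-- The autocorrelation of `x ∈ ℝ^M` (1-based indexing), defined for lags
`l = 1-M, ..., M-1` by `a(l) = ∑_{s = max(1, 1-l)}^{min(M, M-l)} x(s) x(s+l)`. -/
noncomputable def autocorr {M : ℕ} (x : Fin M → ℝ) (l : ℤ) : ℝ :=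
  ∑ s ∈ Finset.Icc (max 1 (1 - l)) (min (M : ℤ) ((M : ℤ) - l)), zext x s * zext x (s + l)

/-- `x ∈ ℝ^M` is collision free if `x(i) - x(j) ≠ x(k) - x(l)` for all pairwise
distinct indices `i, j, k, l` in the support of `x`. -/
def CollisionFree {M : ℕ} (x : Fin M → ℝ) : Prop :=
  ∀ i j k l : Fin M, x i ≠ 0 → x j ≠ 0 → x k ≠ 0 → x l ≠ 0 →
    i ≠ j → i ≠ k → i ≠ l → j ≠ k → j ≠ l → k ≠ l →
    x i - x j ≠ x k - x l

/-- **Sparsity of the autocorrelation.**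
If `x ∈ ℝ^M` is collision free with exactly `k` nonzero entries, then its
autocorrelation `a ∈ ℝ^{2M-1}` (with lags `l = 1-M, ..., M-1`) has at most
`k² - k + 1` nonzero entries. -/
theorem autocorr_sparsity
    (M k : ℕ) (x : Fin M → ℝ)
    (hx : (Finset.univ.filter fun i => x i ≠ 0).card = k)
    (hcf : CollisionFree x) :
    ((Finset.Icc (1 - (M : ℤ)) ((M : ℤ) - 1)).filter fun l => autocorr x l ≠ 0).card ≤
      k ^ 2 - k + 1 := by
  classical
  set S := Finset.univ.filter fun i => x i ≠ 0 with hS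
  have hz : ∀ i : ℤ, zext x i ≠ 0 → ∃ j : Fin M, j ∈ S ∧ (j : ℤ) + 1 = i := by
    intro i hi
    unfold zext at hi
    split_ifs at hi with h
    · refine ⟨_, by simpa [hS] using hi, ?_⟩
      simp only
      omega
    · exact absurd rfl hi
  have hsub : ((Finset.Icc (1 - (M : ℤ)) ((M : ℤ) - 1)).filter fun l => autocorr x l ≠ 0) ⊆
      insert 0 (S.offDiag.image fun p => ((p.2 : ℕ) : ℤ) - ((p.1 : ℕ) : ℤ)) := by
    intro l hl
    obtain ⟨s, -, hs⟩ := Finset.exists_ne_zero_of_sum_ne_zero (Finset.mem_filter.1 hl).2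
    obtain ⟨i, hi, hi'⟩ := hz _ (left_ne_zero_of_mul hs)
    obtain ⟨j, hj, hj'⟩ := hz _ (right_ne_zero_of_mul hs)
    rw [Finset.mem_insert]
    by_cases hij : i = j
    · left
      subst hij
      omega
    · right
      exact Finset.mem_image.2 ⟨(i, j), Finset.mem_offDiag.2 ⟨hi, hj, hij⟩, by simp only; omega⟩
  calc _ ≤ _ := Finset.card_le_card hsub
    _ ≤ _ := Finset.card_insert_le _ _
    _ ≤ S.offDiag.card + 1 := Nat.add_le_add_right Finset.card_image_le 1
    _ = k ^ 2 - k + 1 := by rw [Finset.offDiag_card, hx, sq]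
end

section
/- Let x ∈ ℝ^M be collision free with ‖x‖₀ = k, and let a ∈ ℝ^{2M-1} be its autocorrelation. Then the entries a(1), ..., a(M-1) contain at most (k² - k)/2 nonzero elements. -/
/-- **Sparsity of the positive-lag part of the autocorrelation.**
If `x ∈ ℝ^M` is collision free with exactly `k` nonzero entries, then the entries
`a(1), ..., a(M-1)` of its autocorrelation contain at most `(k² - k)/2` nonzero
elements. -/
theorem autocorr_positive_lag_sparsity
    (M k : ℕ) (x : Fin M → ℝ)
    (hx : (Finset.univ.filter fun i => x i ≠ 0).card = k)
    (hcf : CollisionFree x) :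
    ((Finset.Icc (1 : ℤ) ((M : ℤ) - 1)).filter fun l => autocorr x l ≠ 0).card ≤
      (k ^ 2 - k) / 2 := by
  classical
  set S := Finset.univ.filter fun i => x i ≠ 0 with hS
  let f : Sym2 (Fin M) → ℤ := Sym2.lift
    ⟨fun i j => |((i : ℕ) : ℤ) - ((j : ℕ) : ℤ)|, fun i j => abs_sub_comm _ _⟩
  have hsub : ((Finset.Icc (1 : ℤ) ((M : ℤ) - 1)).filter fun l => autocorr x l ≠ 0) ⊆
      (S.offDiag.image Sym2.mk.uncurry).image f := by
    intro l hl
    rw [Finset.mem_filter, Finset.mem_Icc] at hl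
    obtain ⟨⟨h1, h2⟩, h3⟩ := hl
    obtain ⟨s, hs, hne⟩ := Finset.exists_ne_zero_of_sum_ne_zero h3
    have ha := left_ne_zero_of_mul hne
    have hb := right_ne_zero_of_mul hne
    unfold zext at ha hb
    split_ifs at ha with hA
    · split_ifs at hb with hB
      · refine Finset.mem_image.2 ⟨s(⟨(s - 1).toNat, by omega⟩, ⟨(s + l - 1).toNat, by omega⟩),
          Finset.mem_image.2 ⟨(⟨(s - 1).toNat, by omega⟩, ⟨(s + l - 1).toNat, by omega⟩), ?_, rfl⟩, ?_⟩
        · rw [Finset.mem_offDiag]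
          refine ⟨by simpa [hS] using ha, by simpa [hS] using hb, ?_⟩
          intro h
          have := congrArg Fin.val h
          simp only at this
          omega
        · change |(((s - 1).toNat : ℕ) : ℤ) - (((s + l - 1).toNat : ℕ) : ℤ)| = l
          rw [Int.toNat_of_nonneg (by omega), Int.toNat_of_nonneg (by omega), abs_sub_comm,
            abs_of_nonneg (by omega)]
          omega
      · exact absurd rfl hb
    · exact absurd rfl ha
  refine (Finset.card_le_card hsub).trans (Finset.card_image_le.trans ?_)
  rw [Sym2.card_image_offDiag, hx, Nat.choose_two_right, Nat.mul_sub, mul_one, sq]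
end
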